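/- arXiv:2605.08034 — 3 statements merged into one kernel-verified Lean document; each statement's English description precedes it below -/
import Mathlib

section
/- Let (Ω, F, P) be a probability space, a ∈ {0,1}, I_a : Ω → {0,1} an indicator, κ : Ω → ℝ bounded measurable, X : Ω → 𝒳 measurable, and let G = σ(X) be the σ-algebra generated by X. Let π₀, m : 𝒳 → ℝ be bounded measurable functions such that E[I_a | G] = π₀(X) a.s. and E[I_a κ | G] = π₀(X) m(X) a.s., with π₀(X) ≥ ε > 0 a.s. Let π, r : 𝒳 → ℝ be bounded measurable with π(X) ≥ ε̄ > 0 a.s. Define D = (I_a/π(X))(κ − r(X)) + r(X) − (I_a/π₀(X))(κ − m(X)) − m(X). Then almost surely E[D | G] = ((π₀(X) − π(X))/π(X))·(m(X) − r(X)). -/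
open MeasureTheory

/-- conditional mean of the difference of doubly-robust pseudo-features. -/
theorem stmt1
    {Ω 𝒳 : Type*} [MeasurableSpace Ω] [MeasurableSpace 𝒳]
    (P : Measure Ω) [IsProbabilityMeasure P]
    (a : Fin 2)
    (Ia : Ω → ℝ) (hIa_meas : Measurable Ia)
    (hIa01 : ∀ ω, Ia ω = 0 ∨ Ia ω = 1)
    (κ : Ω → ℝ) (hκ_meas : Measurable κ) (hκ_bdd : ∃ C, ∀ ω, |κ ω| ≤ C)
    (X : Ω → 𝒳) (hX : Measurable X)
    (π₀ m : 𝒳 → ℝ) (hπ₀ : Measurable π₀) (hm : Measurable m)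
    (hπ₀b : ∃ C, ∀ x, |π₀ x| ≤ C) (hmb : ∃ C, ∀ x, |m x| ≤ C)
    (hcond_I : P[Ia | MeasurableSpace.comap X inferInstance] =ᵐ[P] fun ω => π₀ (X ω))
    (hcond_Iκ : P[(fun ω => Ia ω * κ ω) | MeasurableSpace.comap X inferInstance]
        =ᵐ[P] fun ω => π₀ (X ω) * m (X ω))
    (ε : ℝ) (hε : 0 < ε) (hπ₀lb : ∀ᵐ ω ∂P, ε ≤ π₀ (X ω))
    (π r : 𝒳 → ℝ) (hπ : Measurable π) (hr : Measurable r)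
    (hπb : ∃ C, ∀ x, |π x| ≤ C) (hrb : ∃ C, ∀ x, |r x| ≤ C)
    (ε' : ℝ) (hε' : 0 < ε') (hπlb : ∀ᵐ ω ∂P, ε' ≤ π (X ω))
    (D : Ω → ℝ)
    (hD : ∀ ω, D ω = (Ia ω / π (X ω)) * (κ ω - r (X ω)) + r (X ω)
        - (Ia ω / π₀ (X ω)) * (κ ω - m (X ω)) - m (X ω)) :
    P[D | MeasurableSpace.comap X inferInstance]
      =ᵐ[P] fun ω => ((π₀ (X ω) - π (X ω)) / π (X ω)) * (m (X ω) - r (X ω)) := by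
  obtain ⟨Cκ, hCκ⟩ := hκ_bdd
  obtain ⟨Cm, hCm⟩ := hmb
  obtain ⟨Cr, hCr⟩ := hrb
  have hle : MeasurableSpace.comap X inferInstance ≤ (inferInstance : MeasurableSpace Ω) :=
    hX.comap_le
  have hXm : Measurable[MeasurableSpace.comap X inferInstance] X := comap_measurable X
  have hI1 : ∀ ω, |Ia ω| ≤ 1 := by
    intro ω
    rcases hIa01 ω with h | h <;> simp [h]
  have hIint : Integrable Ia P :=
    Integrable.of_bound hIa_meas.aestronglyMeasurable 1 (Filter.Eventually.of_forall hI1)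
  have hIκint : Integrable (fun ω => Ia ω * κ ω) P := by
    refine Integrable.of_bound (hIa_meas.mul hκ_meas).aestronglyMeasurable (1 * Cκ)
      (Filter.Eventually.of_forall fun ω => ?_)
    rw [Real.norm_eq_abs, abs_mul]
    exact mul_le_mul (hI1 ω) (hCκ ω) (abs_nonneg _) zero_le_one
  set f1 : 𝒳 → ℝ := fun x => 1 / π x - 1 / π₀ x with hf1
  set f2 : 𝒳 → ℝ := fun x => m x / π₀ x - r x / π x with hf2
  set f3 : 𝒳 → ℝ := fun x => r x - m x with hf3
  have m1 : Measurable f1 := (measurable_const.div hπ).sub (measurable_const.div hπ₀)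
  have m2 : Measurable f2 := (hm.div hπ₀).sub (hr.div hπ)
  have m3 : Measurable f3 := hr.sub hm
  have s1 : StronglyMeasurable[MeasurableSpace.comap X inferInstance] (fun ω => f1 (X ω)) :=
    (m1.comp hXm).stronglyMeasurable
  have s2 : StronglyMeasurable[MeasurableSpace.comap X inferInstance] (fun ω => f2 (X ω)) :=
    (m2.comp hXm).stronglyMeasurable
  have s3 : StronglyMeasurable[MeasurableSpace.comap X inferInstance] (fun ω => f3 (X ω)) :=
    (m3.comp hXm).stronglyMeasurable
  have key : ∀ (c C e y : ℝ), 0 < e → |c| ≤ C → e ≤ y → |c / y| ≤ C / e := by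
    intro c C e y he hc hy
    rw [abs_div, abs_of_pos (he.trans_le hy)]
    exact div_le_div₀ ((abs_nonneg _).trans hc) hc he hy
  have b1 : ∀ᵐ ω ∂P, ‖f1 (X ω)‖ ≤ 1 / ε' + 1 / ε := by
    filter_upwards [hπ₀lb, hπlb] with ω h0 h1
    exact (abs_sub _ _).trans (add_le_add (key 1 1 _ _ hε' (by simp) h1)
      (key 1 1 _ _ hε (by simp) h0))
  have b2 : ∀ᵐ ω ∂P, ‖f2 (X ω)‖ ≤ Cm / ε + Cr / ε' := by
    filter_upwards [hπ₀lb, hπlb] with ω h0 h1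
    exact (abs_sub _ _).trans (add_le_add (key _ _ _ _ hε (hCm _) h0)
      (key _ _ _ _ hε' (hCr _) h1))
  have i1 : Integrable ((fun ω => f1 (X ω)) * fun ω => Ia ω * κ ω) P :=
    hIκint.bdd_mul (m1.comp hX).aestronglyMeasurable b1
  have i2 : Integrable ((fun ω => f2 (X ω)) * Ia) P :=
    hIint.bdd_mul (m2.comp hX).aestronglyMeasurable b2
  have i3 : Integrable (fun ω => f3 (X ω)) P :=
    Integrable.of_bound (m3.comp hX).aestronglyMeasurable (Cr + Cm)
      (Filter.Eventually.of_forall fun ω =>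
        (abs_sub _ _).trans (add_le_add (hCr _) (hCm _)))
  have hDeq : D = ((fun ω => f1 (X ω)) * fun ω => Ia ω * κ ω) + (fun ω => f2 (X ω)) * Ia
      + fun ω => f3 (X ω) := by
    funext ω
    simp only [Pi.add_apply, Pi.mul_apply, hD, hf1, hf2, hf3]
    ring
  have e1 := condExp_stronglyMeasurable_mul_of_bound hle s1 hIκint _ b1
  have e2 := condExp_stronglyMeasurable_mul_of_bound hle s2 hIint _ b2
  have e3 := condExp_of_stronglyMeasurable hle s3 i3
  have a1 := condExp_add (i1.add i2) i3 (MeasurableSpace.comap X inferInstance)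
  have a2 := condExp_add i1 i2 (MeasurableSpace.comap X inferInstance)
  rw [hDeq]
  filter_upwards [e1, e2, a1, a2, hcond_I, hcond_Iκ, hπ₀lb, hπlb]
    with ω e1 e2 a1 a2 c1 c2 h0 h1
  rw [a1, Pi.add_apply, a2, Pi.add_apply, e1, e2, e3, Pi.mul_apply, Pi.mul_apply, c1, c2]
  have p0 : π₀ (X ω) ≠ 0 := (hε.trans_le h0).ne'
  have p1 : π (X ω) ≠ 0 := (hε'.trans_le h1).ne'
  simp only [hf1, hf2, hf3]
  field_simp
  ring
end

section
/- Under the setting of the conditional-mean identity — (Ω, F, P) a probability space, I_a : Ω → {0,1} an indicator, κ bounded measurable, X measurable, G = σ(X), bounded measurable π₀, m with E[I_a | G] = π₀(X) a.s., E[I_a κ | G] = π₀(X) m(X) a.s., π₀(X) ≥ ε > 0 a.s., and bounded measurable π, r with π(X) ≥ ε̄ > 0 a.s. — define φ = (I_a/π(X))(κ − r(X)) + r(X). Then E[φ] − E[m(X)] = E[ ((π₀(X) − π(X))/π(X))·(m(X) − r(X)) ]. -/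
open MeasureTheory

lemma aux_pull {Ω 𝒳 : Type*} [MeasurableSpace Ω] [m𝒳 : MeasurableSpace 𝒳]
    (P : Measure Ω) [IsProbabilityMeasure P]
    (X : Ω → 𝒳) (hX : Measurable X) (f h : Ω → ℝ) (hf : Integrable f P)
    (hc : P[f | MeasurableSpace.comap X m𝒳] =ᵐ[P] h)
    (g : 𝒳 → ℝ) (hg : Measurable g) (C : ℝ) (hgb : ∀ᵐ ω ∂P, ‖g (X ω)‖ ≤ C) :
    Integrable (fun ω => g (X ω) * f ω) P ∧ Integrable (fun ω => g (X ω) * h ω) P ∧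
    ∫ ω, g (X ω) * f ω ∂P = ∫ ω, g (X ω) * h ω ∂P := by
  have hle : MeasurableSpace.comap X m𝒳 ≤ _ := hX.comap_le
  have hh : Integrable h P := integrable_condExp.congr hc
  have hgX : AEStronglyMeasurable (fun ω => g (X ω)) P :=
    (hg.comp hX).aestronglyMeasurable
  have h1 : Integrable (fun ω => g (X ω) * f ω) P := hf.bdd_mul hgX hgb
  refine ⟨h1, hh.bdd_mul hgX hgb, ?_⟩
  have hsm : StronglyMeasurable[MeasurableSpace.comap X m𝒳] (fun ω => g (X ω)) :=
    (hg.comp (comap_measurable X)).stronglyMeasurable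
  have h2 := condExp_mul_of_stronglyMeasurable_left (μ := P) hsm h1 hf
  rw [← integral_condExp hle (f := fun ω => g (X ω) * f ω)]
  apply integral_congr_ae
  filter_upwards [h2, hc] with ω a b
  rw [← b]
  exact a

/-- bias identity for the augmented (doubly robust) pseudo-feature. -/
theorem stmt2
    {Ω 𝒳 : Type*} [MeasurableSpace Ω] [MeasurableSpace 𝒳]
    (P : Measure Ω) [IsProbabilityMeasure P]
    (a : Fin 2)
    (Ia : Ω → ℝ) (hIa_meas : Measurable Ia)
    (hIa01 : ∀ ω, Ia ω = 0 ∨ Ia ω = 1)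
    (κ : Ω → ℝ) (hκ_meas : Measurable κ) (hκ_bdd : ∃ C, ∀ ω, |κ ω| ≤ C)
    (X : Ω → 𝒳) (hX : Measurable X)
    (π₀ m : 𝒳 → ℝ) (hπ₀ : Measurable π₀) (hm : Measurable m)
    (hπ₀b : ∃ C, ∀ x, |π₀ x| ≤ C) (hmb : ∃ C, ∀ x, |m x| ≤ C)
    (hcond_I : P[Ia | MeasurableSpace.comap X inferInstance] =ᵐ[P] fun ω => π₀ (X ω))
    (hcond_Iκ : P[(fun ω => Ia ω * κ ω) | MeasurableSpace.comap X inferInstance]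
        =ᵐ[P] fun ω => π₀ (X ω) * m (X ω))
    (ε : ℝ) (hε : 0 < ε) (hπ₀lb : ∀ᵐ ω ∂P, ε ≤ π₀ (X ω))
    (π r : 𝒳 → ℝ) (hπ : Measurable π) (hr : Measurable r)
    (hπb : ∃ C, ∀ x, |π x| ≤ C) (hrb : ∃ C, ∀ x, |r x| ≤ C)
    (ε' : ℝ) (hε' : 0 < ε') (hπlb : ∀ᵐ ω ∂P, ε' ≤ π (X ω))
    (φ : Ω → ℝ)
    (hφ : ∀ ω, φ ω = (Ia ω / π (X ω)) * (κ ω - r (X ω)) + r (X ω)) :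
    (∫ ω, φ ω ∂P) - (∫ ω, m (X ω) ∂P)
      = ∫ ω, ((π₀ (X ω) - π (X ω)) / π (X ω)) * (m (X ω) - r (X ω)) ∂P := by
  obtain ⟨Cκ, hCκ⟩ := hκ_bdd
  obtain ⟨Cm, hCm⟩ := hmb
  obtain ⟨Cr, hCr⟩ := hrb
  have hIb : ∀ ω, ‖Ia ω‖ ≤ 1 := fun ω => by rcases hIa01 ω with h | h <;> simp [h]
  have hI : Integrable Ia P :=
    Integrable.of_bound hIa_meas.aestronglyMeasurable 1 (Filter.Eventually.of_forall hIb)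
  have hκi : Integrable κ P :=
    Integrable.of_bound hκ_meas.aestronglyMeasurable Cκ (Filter.Eventually.of_forall hCκ)
  have hIκ : Integrable (fun ω => Ia ω * κ ω) P :=
    hκi.bdd_mul hIa_meas.aestronglyMeasurable (Filter.Eventually.of_forall hIb)
  have hmi : Integrable (fun ω => m (X ω)) P :=
    Integrable.of_bound (hm.comp hX).aestronglyMeasurable Cm
      (Filter.Eventually.of_forall fun ω => hCm _)
  have hri : Integrable (fun ω => r (X ω)) P :=
    Integrable.of_bound (hr.comp hX).aestronglyMeasurable Cr
      (Filter.Eventually.of_forall fun ω => hCr _)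
  have hinv : ∀ᵐ ω ∂P, ‖(π (X ω))⁻¹‖ ≤ ε'⁻¹ := by
    filter_upwards [hπlb] with ω h
    rw [norm_inv, Real.norm_of_nonneg (hε'.le.trans h)]
    exact inv_anti₀ hε' h
  obtain ⟨a1, a2, a3⟩ := aux_pull P X hX _ _ hIκ hcond_Iκ (fun x => (π x)⁻¹) hπ.inv _ hinv
  obtain ⟨b1, b2, b3⟩ := aux_pull P X hX _ _ hI hcond_I (fun x => r x * (π x)⁻¹)
    (hr.mul hπ.inv) (Cr * ε'⁻¹) (by
      filter_upwards [hinv] with ω h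
      rw [norm_mul]
      exact mul_le_mul (hCr _) h (norm_nonneg _) ((abs_nonneg _).trans (hCr (X ω))))
  have e1 : ∫ ω, φ ω ∂P = ∫ ω, ((π (X ω))⁻¹ * (Ia ω * κ ω)
      - r (X ω) * (π (X ω))⁻¹ * Ia ω) + r (X ω) ∂P := by
    congr 1
    ext ω
    rw [hφ]
    ring
  have e2 : ∫ ω, ((π₀ (X ω) - π (X ω)) / π (X ω)) * (m (X ω) - r (X ω)) ∂P
      = ∫ ω, (((π (X ω))⁻¹ * (π₀ (X ω) * m (X ω))
      - r (X ω) * (π (X ω))⁻¹ * π₀ (X ω)) + r (X ω)) - m (X ω) ∂P := by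
    apply integral_congr_ae
    filter_upwards [hπlb] with ω h
    have : π (X ω) ≠ 0 := (hε'.trans_le h).ne'
    field_simp
    ring
  rw [e1, e2, integral_add (by exact a1.sub b1) hri, integral_sub a1 b1,
    integral_sub (by exact (a2.sub b2).add hri) hmi, integral_add (by exact a2.sub b2) hri,
    integral_sub a2 b2, a3, b3]
end

section
/- Let (Ω, F, P) be a probability space, X : Ω → 𝒳 measurable, I_a : Ω → {0,1} an indicator, Y_a : Ω → 𝒴 measurable, and k : 𝒴 → ℝ bounded measurable. Let G = σ(X), and let π₀ : 𝒳 → ℝ be bounded measurable with E[I_a | G] = π₀(X) a.s. and π₀(X) ≥ ε > 0 a.s. Assume the conditional mean independence E[ I_a · k(Y_a) | G ] = π₀(X) · E[ k(Y_a) | G ] almost surely. Let Y : Ω → 𝒴 be measurable with I_a·k(Y) = I_a·k(Y_a) everywhere (consistency on the event {I_a = 1}). Then E[ (I_a/π₀(X)) · k(Y) ] = E[ k(Y_a) ]. -/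
open MeasureTheory

/-- inverse-propensity identification of the interventional kernel moment. -/
theorem stmt5
    {Ω 𝒳 𝒴 : Type*} [MeasurableSpace Ω] [MeasurableSpace 𝒳] [MeasurableSpace 𝒴]
    (P : Measure Ω) [IsProbabilityMeasure P]
    (X : Ω → 𝒳) (hX : Measurable X)
    (Ia : Ω → ℝ) (hIa_meas : Measurable Ia)
    (hIa01 : ∀ ω, Ia ω = 0 ∨ Ia ω = 1)
    (Ya : Ω → 𝒴) (hYa : Measurable Ya)
    (k : 𝒴 → ℝ) (hk_meas : Measurable k) (hk_bdd : ∃ C, ∀ y, |k y| ≤ C)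
    (π₀ : 𝒳 → ℝ) (hπ₀_meas : Measurable π₀) (hπ₀_bdd : ∃ C, ∀ x, |π₀ x| ≤ C)
    (hcond_I : P[Ia | MeasurableSpace.comap X inferInstance] =ᵐ[P] fun ω => π₀ (X ω))
    (ε : ℝ) (hε : 0 < ε) (hπ₀lb : ∀ᵐ ω ∂P, ε ≤ π₀ (X ω))
    (hexch : P[(fun ω => Ia ω * k (Ya ω)) | MeasurableSpace.comap X inferInstance]
        =ᵐ[P] fun ω =>
          π₀ (X ω) * (P[(fun ω' => k (Ya ω')) | MeasurableSpace.comap X inferInstance]) ω)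
    (Y : Ω → 𝒴) (hY : Measurable Y)
    (hconsistency : ∀ ω, Ia ω * k (Y ω) = Ia ω * k (Ya ω)) :
    ∫ ω, (Ia ω / π₀ (X ω)) * k (Y ω) ∂P = ∫ ω, k (Ya ω) ∂P := by
  obtain ⟨C, hC⟩ := hk_bdd
  have hm : MeasurableSpace.comap X inferInstance ≤ (inferInstance : MeasurableSpace Ω) :=
    hX.comap_le
  have hf : StronglyMeasurable[MeasurableSpace.comap X inferInstance]
      (fun ω => (π₀ (X ω))⁻¹) :=
    (hπ₀_meas.inv.comp (comap_measurable X)).stronglyMeasurable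
  have hg : Integrable (fun ω => Ia ω * k (Ya ω)) P := by
    refine Integrable.of_bound
      (hIa_meas.mul (hk_meas.comp hYa)).aestronglyMeasurable C (ae_of_all _ fun ω => ?_)
    have h0 := hC (Ya ω)
    have h1 := (abs_nonneg _).trans h0
    rcases hIa01 ω with h | h <;> simp [h, h0, h1]
  have hb : ∀ᵐ ω ∂P, ‖(π₀ (X ω))⁻¹‖ ≤ ε⁻¹ := by
    filter_upwards [hπ₀lb] with ω h
    rw [Real.norm_eq_abs, abs_of_nonneg (inv_nonneg.2 (hε.le.trans h))]
    exact inv_anti₀ hε h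
  have key := condExp_stronglyMeasurable_mul_of_bound hm hf hg ε⁻¹ hb
  have h1 : ∀ ω, (Ia ω / π₀ (X ω)) * k (Y ω)
      = ((fun ω => (π₀ (X ω))⁻¹) * (fun ω => Ia ω * k (Ya ω))) ω := by
    intro ω
    simp only [Pi.mul_apply]
    rw [← hconsistency ω]
    ring
  rw [integral_congr_ae (ae_of_all _ h1), ← integral_condExp hm,
    ← integral_condExp hm (f := fun ω => k (Ya ω))]
  refine integral_congr_ae ?_
  filter_upwards [key, hexch, hπ₀lb] with ω h2 h3 h4
  rw [h2, Pi.mul_apply, h3, inv_mul_cancel_left₀ (hε.trans_le h4).ne']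
end
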